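/- Let Γ be a countable discrete group. If Γ is exact, then every IRE on Γ that is a weak limit (in the weak topology on Borel probability measures on E) of a sequence of finite IREs is an amenable IRE. -/

import Mathlib

open MeasureTheory Filter Topology

/-- A function `r : Γ × Γ → Bool` codes an equivalence relation on `Γ`. -/
def IsEqRel {Γ : Type*} (r : Γ × Γ → Bool) : Prop :=
  (∀ x, r (x, x) = true) ∧ (∀ x y, r (x, y) = true → r (y, x) = true) ∧
    (∀ x y z, r (x, y) = true → r (y, z) = true → r (x, z) = true)

/-- The space `E` of equivalence relations on `Γ`, as a subspace of `{0,1}^{Γ×Γ}`. -/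
abbrev EqRelSpace (Γ : Type*) : Type _ := ↥{r : Γ × Γ → Bool | IsEqRel r}

variable {Γ : Type*} [Group Γ]

/-- The left shift action of `Γ` on the space of equivalence relations:
`(γ·r)(x,y) = r(γ⁻¹x, γ⁻¹y)`. -/
def shiftE (γ : Γ) (r : EqRelSpace Γ) : EqRelSpace Γ :=
  ⟨fun p => r.1 (γ⁻¹ * p.1, γ⁻¹ * p.2),
    ⟨fun _ => r.2.1 _, fun _ _ h => r.2.2.1 _ _ h, fun _ _ _ h h' => r.2.2.2 _ _ _ h h'⟩⟩

/-- The `r`-class of `g ∈ Γ`. -/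
def classOf (r : EqRelSpace Γ) (g : Γ) : Set Γ := {h | r.1 (g, h) = true}

/-- An invariant random equivalence relation: a Borel probability measure on `E`
invariant under the left shift action. -/
def IsIRE (ρ : ProbabilityMeasure (EqRelSpace Γ)) : Prop :=
  ∀ γ : Γ, ρ.toMeasure.map (shiftE γ) = ρ.toMeasure

/-- A finite IRE: almost every equivalence relation has all classes finite. -/
def IsFIRE (ρ : ProbabilityMeasure (EqRelSpace Γ)) : Prop :=
  IsIRE ρ ∧ ∀ᵐ r ∂ρ.toMeasure, ∀ g : Γ, (classOf r g).Finite

/-- An amenable IRE: there are Borel maps `λ_n : E → Prob(Γ)` (coded coordinatewise as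
`lam : ℕ → E → Γ → ℝ`) such that for a.e. `r` and every `g` in the class of the identity,
`‖g⁻¹·λ_n^r − λ_n^{g⁻¹·r}‖₁ → 0`; here `(g⁻¹·λ_n^r)(h) = λ_n^r(gh)`. -/
def IsAIRE (ρ : ProbabilityMeasure (EqRelSpace Γ)) : Prop :=
  IsIRE ρ ∧ ∃ lam : ℕ → EqRelSpace Γ → Γ → ℝ,
    (∀ n g, Measurable fun r => lam n r g) ∧
    (∀ n r g, 0 ≤ lam n r g) ∧
    (∀ n r, ∑' g, lam n r g = 1) ∧
    ∀ᵐ r ∂ρ.toMeasure, ∀ g ∈ classOf r 1,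
      Tendsto (fun n => ∑' h : Γ, |lam n r (g * h) - lam n (shiftE g⁻¹ r) h|) atTop (𝓝 0)

/-- Topological amenability of an action `a : Γ → X → X` on a topological space:
there are continuous maps `η_n : X → Prob(Γ)` (coded coordinatewise) with
`sup_x ‖γ·η_n^x − η_n^{γ·x}‖₁ → 0` for every `γ`; here `(γ·η)(g) = η(γ⁻¹g)`. -/
def TopAmenableAction (Γ : Type*) [Group Γ] {X : Type*} [TopologicalSpace X]
    (a : Γ → X → X) : Prop :=
  ∃ η : ℕ → X → Γ → ℝ,
    (∀ n x g, 0 ≤ η n x g) ∧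
    (∀ n x, ∑' g, η n x g = 1) ∧
    (∀ n g, Continuous fun x => η n x g) ∧
    ∀ γ : Γ, ∀ ε > (0 : ℝ), ∃ N, ∀ n ≥ N, ∀ x : X,
      ∑' g : Γ, |η n x (γ⁻¹ * g) - η n (a γ x) g| < ε

/-- A countable group is exact iff it admits a topologically amenable continuous action
on a nonempty compact metrizable space. -/
def IsExactGroup (Γ : Type*) [Group Γ] : Prop :=
  ∃ (X : Type) (_ : TopologicalSpace X) (a : Γ → X → X),
    Nonempty X ∧ CompactSpace X ∧ TopologicalSpace.MetrizableSpace X ∧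
    (∀ x, a 1 x = x) ∧ (∀ γ δ x, a (γ * δ) x = a γ (a δ x)) ∧
    (∀ γ, Continuous (a γ)) ∧ TopAmenableAction Γ a

open scoped ENNReal NNReal BoundedContinuousFunction

section Shift

theorem continuous_shiftE (γ : Γ) : Continuous (shiftE γ : EqRelSpace Γ → EqRelSpace Γ) :=
  Continuous.subtype_mk
    (continuous_pi fun p =>
      (continuous_apply (γ⁻¹ * p.1, γ⁻¹ * p.2)).comp continuous_subtype_val) _

theorem measurable_shiftE (γ : Γ) : Measurable (shiftE γ : EqRelSpace Γ → EqRelSpace Γ) :=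
  Measurable.subtype_mk
    (measurable_pi_lambda _ fun p =>
      (measurable_pi_apply (γ⁻¹ * p.1, γ⁻¹ * p.2)).comp measurable_subtype_coe)

theorem shiftE_shiftE_inv (γ : Γ) (r : EqRelSpace Γ) : shiftE γ (shiftE γ⁻¹ r) = r := by
  apply Subtype.ext
  funext p
  simp [shiftE]

theorem isClosed_setOf_isEqRel (Γ : Type*) : IsClosed {r : Γ × Γ → Bool | IsEqRel r} := by
  have hc : ∀ p : Γ × Γ, IsClopen {r : Γ × Γ → Bool | r p = true} := fun p =>
    (isClopen_discrete {true}).preimage (continuous_apply p)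
  have himp : ∀ {p q : (Γ × Γ → Bool) → Prop}, IsClopen {r | p r} → IsClosed {r | q r} →
      IsClosed {r | p r → q r} := fun hp hq => by
    simpa only [imp_iff_not_or, Set.ofPred_or, ← Set.compl_ofPred] using hp.compl.isClosed.union hq
  simp only [IsEqRel, Set.ofPred_and, Set.ofPred_forall]
  refine (isClosed_iInter fun x => (hc _).isClosed).inter (IsClosed.inter ?_ ?_)
  · exact isClosed_iInter fun x => isClosed_iInter fun y => himp (hc _) (hc _).isClosed
  · exact isClosed_iInter fun x => isClosed_iInter fun y => isClosed_iInter fun z =>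
      himp (hc _) (himp (hc _) (hc _).isClosed)

instance instCompactSpaceEqRelSpace (Γ : Type*) : CompactSpace (EqRelSpace Γ) :=
  isCompact_iff_compactSpace.mp (isClosed_setOf_isEqRel Γ).isCompact

/-- The indicator of the event that `g` is equivalent to the identity. -/
def classIndicator (g : Γ) (r : EqRelSpace Γ) : ℝ≥0 := if r.1 (1, g) = true then 1 else 0

theorem continuous_classIndicator (g : Γ) : Continuous (classIndicator g) :=
  (continuous_of_discreteTopology (f := fun b : Bool => if b = true then (1 : ℝ≥0) else 0)).comp
    ((continuous_apply (1, g)).comp continuous_subtype_val)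

theorem measurable_classIndicator (g : Γ) : Measurable (classIndicator g) :=
  (measurable_of_countable (fun b : Bool => if b = true then (1 : ℝ≥0) else 0)).comp
    ((measurable_pi_apply (1, g)).comp measurable_subtype_coe)

theorem classIndicator_inv_shiftE (g : Γ) (r : EqRelSpace Γ) :
    classIndicator g⁻¹ (shiftE g⁻¹ r) = classIndicator g r := by
  have h : r.1 (g, 1) = true ↔ r.1 (1, g) = true := ⟨r.2.2.1 _ _, r.2.2.1 _ _⟩
  simp [classIndicator, shiftE, h]

theorem classIndicator_shiftE_of_mem {g : Γ} {r : EqRelSpace Γ} (hg : r.1 (1, g) = true) (h : Γ) :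
    classIndicator (g⁻¹ * h) (shiftE g⁻¹ r) = classIndicator h r := by
  have : r.1 (g, h) = true ↔ r.1 (1, h) = true :=
    ⟨r.2.2.2 _ _ _ hg, r.2.2.2 _ _ _ (r.2.2.1 _ _ hg)⟩
  simp [classIndicator, shiftE, this]

/-- The uniform weight of `h` on the class of the identity. -/
noncomputable def classWeight (h : Γ) (r : EqRelSpace Γ) : ℝ≥0∞ :=
  classIndicator h r / ∑' k, (classIndicator k r : ℝ≥0∞)

theorem measurable_classWeight [Countable Γ] (h : Γ) : Measurable (classWeight h) :=
  (measurable_classIndicator h).coe_nnreal_ennreal.div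
    (Measurable.tsum fun k => (measurable_classIndicator k).coe_nnreal_ennreal)

theorem classWeight_shiftE_of_mem {g : Γ} {r : EqRelSpace Γ} (hg : r.1 (1, g) = true) (h : Γ) :
    classWeight (g⁻¹ * h) (shiftE g⁻¹ r) = classWeight h r := by
  unfold classWeight
  rw [classIndicator_shiftE_of_mem hg, ← (Equiv.mulLeft g⁻¹).tsum_eq]
  simp only [Equiv.coe_mulLeft, classIndicator_shiftE_of_mem hg]

theorem tsum_classWeight {r : EqRelSpace Γ} (hr : (classOf r 1).Finite) :
    ∑' h, classWeight h r = 1 := by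
  simp only [classWeight, div_eq_mul_inv, ENNReal.tsum_mul_right]
  refine ENNReal.mul_inv_cancel ?_ ?_
  · intro h0
    have := ENNReal.tsum_eq_zero.mp h0 1
    simp [classIndicator, r.2.1] at this
  · rw [tsum_eq_sum (s := hr.toFinset)]
    · exact (ENNReal.sum_lt_top.mpr fun _ _ => ENNReal.coe_lt_top).ne
    · intro b hb
      have : ¬ r.1 (1, b) = true := by simpa [classOf] using hb
      simp [classIndicator, this]

theorem IsIRE.lintegral_shiftE {ρ : ProbabilityMeasure (EqRelSpace Γ)} (hρ : IsIRE ρ) (γ : Γ)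
    {F : EqRelSpace Γ → ℝ≥0∞} (hF : Measurable F) :
    ∫⁻ r, F (shiftE γ r) ∂ρ.toMeasure = ∫⁻ r, F r ∂ρ.toMeasure := by
  rw [← lintegral_map hF (measurable_shiftE γ), hρ γ]

end Shift

section ClassInvariant

variable {X : Type*} [MeasurableSpace X] (a : Γ → X → X)

/-- A measure on `E × X` is class invariant if it is invariant under the partial maps
`(r, x) ↦ (g⁻¹ • r, g⁻¹ • x)` defined where `g` is equivalent to the identity. -/
def IsClassInvariant (m : Measure (EqRelSpace Γ × X)) : Prop :=
  ∀ (g : Γ) (F : EqRelSpace Γ × X → ℝ≥0∞), Measurable F →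
    ∫⁻ z, classIndicator g z.1 * F (shiftE g⁻¹ z.1, a g⁻¹ z.2) ∂m =
      ∫⁻ z, classIndicator g⁻¹ z.1 * F z ∂m

/-- The measure on `E × X` whose fibre over `r` is uniform on the translates of `x₀` by the class
of the identity. -/
noncomputable def classAverage (ρ : Measure (EqRelSpace Γ)) (x₀ : X) :
    Measure (EqRelSpace Γ × X) :=
  Measure.sum fun h : Γ => (ρ.withDensity (classWeight h)).map fun r => (r, a h x₀)

variable {a} [Countable Γ]

theorem lintegral_classAverage (ρ : Measure (EqRelSpace Γ)) (x₀ : X)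
    {F : EqRelSpace Γ × X → ℝ≥0∞} (hF : Measurable F) :
    ∫⁻ z, F z ∂(classAverage a ρ x₀) = ∑' h, ∫⁻ r, classWeight h r * F (r, a h x₀) ∂ρ := by
  rw [classAverage, lintegral_sum_measure]
  refine tsum_congr fun h => ?_
  rw [lintegral_map hF measurable_prodMk_right]
  exact lintegral_withDensity_eq_lintegral_mul _ (measurable_classWeight h)
    (hF.comp measurable_prodMk_right)

theorem IsFIRE.fst_classAverage {ρ : ProbabilityMeasure (EqRelSpace Γ)} (hρ : IsFIRE ρ) (x₀ : X) :
    (classAverage a ρ.toMeasure x₀).fst = ρ.toMeasure := by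
  refine Measure.ext_of_lintegral _ fun f hf => ?_
  rw [Measure.fst, lintegral_map hf measurable_fst,
    lintegral_classAverage _ _ (F := fun z => f z.1) (hf.comp measurable_fst),
    ← lintegral_tsum (f := fun h r => classWeight h r * f r)
      fun h => ((measurable_classWeight h).mul hf).aemeasurable]
  refine lintegral_congr_ae ?_
  filter_upwards [hρ.2] with r hr
  rw [ENNReal.tsum_mul_right, tsum_classWeight (hr 1), one_mul]

theorem IsIRE.isClassInvariant_classAverage {ρ : ProbabilityMeasure (EqRelSpace Γ)}
    (hρ : IsIRE ρ) (x₀ : X) (ha : ∀ g, Measurable (a g))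
    (hmul : ∀ γ δ x, a (γ * δ) x = a γ (a δ x)) :
    IsClassInvariant a (classAverage a ρ.toMeasure x₀) := by
  intro g F hF
  have hT : Measurable fun z : EqRelSpace Γ × X => F (shiftE g⁻¹ z.1, a g⁻¹ z.2) :=
    hF.comp (((measurable_shiftE _).comp measurable_fst).prodMk ((ha _).comp measurable_snd))
  have hI : ∀ g : Γ, Measurable fun z : EqRelSpace Γ × X => (classIndicator g z.1 : ℝ≥0∞) :=
    fun g => ((measurable_classIndicator g).comp measurable_fst).coe_nnreal_ennreal
  rw [lintegral_classAverage _ _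
      (F := fun z => classIndicator g z.1 * F (shiftE g⁻¹ z.1, a g⁻¹ z.2)) ((hI g).mul hT),
    lintegral_classAverage _ _ (F := fun z => classIndicator g⁻¹ z.1 * F z) ((hI g⁻¹).mul hF)]
  refine Eq.trans (tsum_congr fun h => ?_) ((Equiv.mulLeft g⁻¹).tsum_eq _)
  have hm : Measurable fun r => classWeight (g⁻¹ * h) r *
      ((classIndicator g⁻¹ r : ℝ≥0∞) * F (r, a (g⁻¹ * h) x₀)) :=
    (measurable_classWeight _).mul ((measurable_classIndicator _).coe_nnreal_ennreal.mul
      (hF.comp measurable_prodMk_right))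
  rw [Equiv.coe_mulLeft, ← hρ.lintegral_shiftE g⁻¹ hm]
  refine lintegral_congr fun r => ?_
  rw [classIndicator_inv_shiftE]
  by_cases hg : r.1 (1, g) = true
  · rw [classWeight_shiftE_of_mem hg, hmul]
  · simp [classIndicator, hg]

end ClassInvariant

section Limit

variable {X : Type*} [TopologicalSpace X] [CompactSpace X] [TopologicalSpace.MetrizableSpace X]
  [SecondCountableTopology X] [MeasurableSpace X] [BorelSpace X] {a : Γ → X → X} [Countable Γ]

theorem isClassInvariant_of_tendsto {ι : Type*} {l : Filter ι} [l.NeBot]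
    (ha : ∀ g, Continuous (a g))
    {ms : ι → ProbabilityMeasure (EqRelSpace Γ × X)} {m : ProbabilityMeasure (EqRelSpace Γ × X)}
    (hms : ∀ i, IsClassInvariant a (ms i).toMeasure) (hlim : Tendsto ms l (𝓝 m)) :
    IsClassInvariant a m.toMeasure := by
  intro g F hF
  have hTc : Continuous fun z : EqRelSpace Γ × X => (shiftE g⁻¹ z.1, a g⁻¹ z.2) :=
    ((continuous_shiftE _).comp continuous_fst).prodMk ((ha _).comp continuous_snd)
  have hI : ∀ g : Γ, Measurable fun z : EqRelSpace Γ × X => (classIndicator g z.1 : ℝ≥0∞) :=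
    fun g => ((measurable_classIndicator g).comp measurable_fst).coe_nnreal_ennreal
  have hle : ∀ (g : Γ) (z : EqRelSpace Γ × X), (classIndicator g z.1 : ℝ≥0∞) ≤ 1 := fun g z => by
    unfold classIndicator; split_ifs <;> simp
  have hfin : ∀ g : Γ, IsFiniteMeasure
      (m.toMeasure.withDensity fun z => (classIndicator g z.1 : ℝ≥0∞)) := fun g =>
    isFiniteMeasure_withDensity
      ((lintegral_mono (hle g)).trans_lt (by simp)).ne
  have := hfin g
  have hdens : ∀ G : EqRelSpace Γ × X → ℝ≥0∞, Measurable G → ∀ g : Γ,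
      ∫⁻ z, G z ∂(m.toMeasure.withDensity fun z => (classIndicator g z.1 : ℝ≥0∞)) =
        ∫⁻ z, classIndicator g z.1 * G z ∂m.toMeasure := fun G hG g =>
    lintegral_withDensity_eq_lintegral_mul _ (hI g) hG
  have key : (m.toMeasure.withDensity fun z => (classIndicator g z.1 : ℝ≥0∞)).map
      (fun z => (shiftE g⁻¹ z.1, a g⁻¹ z.2)) =
      m.toMeasure.withDensity fun z => (classIndicator g⁻¹ z.1 : ℝ≥0∞) := by
    refine ext_of_forall_lintegral_eq_of_IsFiniteMeasure fun f => ?_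
    have hf : Measurable fun z => (f z : ℝ≥0∞) := f.continuous.measurable.coe_nnreal_ennreal
    rw [lintegral_map hf hTc.measurable,
      hdens (fun z => f (shiftE g⁻¹ z.1, a g⁻¹ z.2)) (hf.comp hTc.measurable), hdens _ hf]
    let f₁ : EqRelSpace Γ × X →ᵇ ℝ≥0 := BoundedContinuousFunction.mkOfCompact
      ⟨fun z => classIndicator g z.1 * f (shiftE g⁻¹ z.1, a g⁻¹ z.2),
        ((continuous_classIndicator g).comp continuous_fst).mul (f.continuous.comp hTc)⟩
    let f₂ : EqRelSpace Γ × X →ᵇ ℝ≥0 := BoundedContinuousFunction.mkOfCompact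
      ⟨fun z => classIndicator g⁻¹ z.1 * f z,
        ((continuous_classIndicator g⁻¹).comp continuous_fst).mul f.continuous⟩
    have h₁ := ProbabilityMeasure.tendsto_iff_forall_lintegral_tendsto.mp hlim f₁
    have h₂ := ProbabilityMeasure.tendsto_iff_forall_lintegral_tendsto.mp hlim f₂
    have h₁₂ : ∀ i, ∫⁻ z, f₁ z ∂(ms i).toMeasure = ∫⁻ z, f₂ z ∂(ms i).toMeasure := fun i => by
      simpa [f₁, f₂] using hms i g _ hf
    simp only [h₁₂] at h₁
    simpa [f₁, f₂] using tendsto_nhds_unique h₁ h₂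
  rw [← hdens F hF, ← key, lintegral_map hF hTc.measurable]
  exact (hdens _ (hF.comp hTc.measurable) g).symm

theorem exists_isClassInvariant_fst_eq [Nonempty X] (ha : ∀ g, Continuous (a g))
    (hmul : ∀ γ δ x, a (γ * δ) x = a γ (a δ x))
    {ρs : ℕ → ProbabilityMeasure (EqRelSpace Γ)} {ρ : ProbabilityMeasure (EqRelSpace Γ)}
    (hfin : ∀ n, IsFIRE (ρs n)) (hlim : Tendsto ρs atTop (𝓝 ρ)) :
    ∃ m : ProbabilityMeasure (EqRelSpace Γ × X),
      IsClassInvariant a m.toMeasure ∧ m.toMeasure.fst = ρ.toMeasure := by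
  obtain ⟨x₀⟩ := ‹Nonempty X›
  have hprob : ∀ n, IsProbabilityMeasure (classAverage a (ρs n).toMeasure x₀) := fun n =>
    ⟨by rw [← Measure.fst_univ, (hfin n).fst_classAverage, measure_univ]⟩
  let ms : ℕ → ProbabilityMeasure (EqRelSpace Γ × X) := fun n => ⟨_, hprob n⟩
  let u : Ultrafilter ℕ := Ultrafilter.of atTop
  have hu : (u : Filter ℕ) ≤ atTop := Ultrafilter.of_le atTop
  obtain ⟨m, -, hm⟩ := isCompact_univ.ultrafilter_le_nhds (u.map ms) (by simp)
  have hm : Tendsto ms u (𝓝 m) := hm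
  refine ⟨m, isClassInvariant_of_tendsto ha (fun n => ?_) hm, ?_⟩
  · exact (hfin n).1.isClassInvariant_classAverage x₀ (fun g => (ha g).measurable) hmul
  · have h₁ := ((ProbabilityMeasure.continuous_map
      (continuous_fst : Continuous (Prod.fst : EqRelSpace Γ × X → _))).tendsto m).comp hm
    have h₂ : Tendsto (fun n => (ms n).map continuous_fst.measurable.aemeasurable) u (𝓝 ρ) := by
      refine (hlim.mono_left hu).congr fun n => ?_
      exact Subtype.ext ((hfin n).fst_classAverage x₀).symm
    exact congrArg ProbabilityMeasure.toMeasure (tendsto_nhds_unique h₁ h₂)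

end Limit

section Disintegration

variable {X : Type*} [MeasurableSpace X] [StandardBorelSpace X] [Nonempty X] {a : Γ → X → X}

theorem IsClassInvariant.ae_lintegral_condKernel {m : Measure (EqRelSpace Γ × X)}
    [IsFiniteMeasure m] (hm : IsClassInvariant a m) (ha : ∀ g, Measurable (a g))
    {ρ : ProbabilityMeasure (EqRelSpace Γ)} (hρ : IsIRE ρ) (hfst : m.fst = ρ.toMeasure)
    {f : X → ℝ≥0∞} (hf : Measurable f) (g : Γ) :
    ∀ᵐ r ∂ρ.toMeasure, g ∈ classOf r 1 →
      ∫⁻ x, f (a g⁻¹ x) ∂(m.condKernel r) = ∫⁻ x, f x ∂(m.condKernel (shiftE g⁻¹ r)) := by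
  have hI : ∀ g : Γ, Measurable fun r : EqRelSpace Γ => (classIndicator g r : ℝ≥0∞) :=
    fun g => (measurable_classIndicator g).coe_nnreal_ennreal
  have hK : ∀ {f : X → ℝ≥0∞}, Measurable f → Measurable fun r => ∫⁻ x, f x ∂(m.condKernel r) :=
    fun hf => hf.lintegral_kernel
  have hint : ∀ {F : EqRelSpace Γ → ℝ≥0∞} {f : X → ℝ≥0∞}, Measurable F → Measurable f →
      ∫⁻ z, F z.1 * f z.2 ∂m = ∫⁻ r, F r * ∫⁻ x, f x ∂(m.condKernel r) ∂ρ.toMeasure := by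
    intro F f hF hf
    rw [← Measure.lintegral_condKernel (f := fun z : EqRelSpace Γ × X => F z.1 * f z.2)
      ((hF.comp measurable_fst).mul (hf.comp measurable_snd)), hfst]
    exact lintegral_congr fun r => lintegral_const_mul (F r) hf
  have key : (fun r => classIndicator g r * ∫⁻ x, f (a g⁻¹ x) ∂(m.condKernel r)) =ᵐ[ρ.toMeasure]
      fun r => classIndicator g r * ∫⁻ x, f x ∂(m.condKernel (shiftE g⁻¹ r)) := by
    refine ae_eq_of_forall_setLIntegral_eq_of_sigmaFinite
      ((hI g).mul (hK (hf.comp (ha _)))) ((hI g).mul ((hK hf).comp (measurable_shiftE _)))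
      fun s hs _ => ?_
    let B : EqRelSpace Γ → ℝ≥0∞ := s.indicator 1
    have hB : Measurable B := measurable_one.indicator hs
    have hs' : ∀ G : EqRelSpace Γ → ℝ≥0∞,
        ∫⁻ r in s, G r ∂ρ.toMeasure = ∫⁻ r, B r * G r ∂ρ.toMeasure := fun G => by
      rw [← lintegral_indicator hs]
      refine lintegral_congr fun r => ?_
      by_cases h : r ∈ s <;> simp [B, h]
    have hBg : Measurable fun r => B (shiftE g r) := hB.comp (measurable_shiftE g)
    have h := hm g (fun z => B (shiftE g z.1) * f z.2)
      ((hBg.comp measurable_fst).mul (hf.comp measurable_snd))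
    simp only [shiftE_shiftE_inv, ← mul_assoc] at h
    rw [hint (F := fun r => classIndicator g r * B r) (f := fun x => f (a g⁻¹ x))
        ((hI g).mul hB) (hf.comp (ha g⁻¹)),
      hint (F := fun r => classIndicator g⁻¹ r * B (shiftE g r)) ((hI g⁻¹).mul hBg) hf,
      ← hρ.lintegral_shiftE g⁻¹ (F := fun r => classIndicator g⁻¹ r * B (shiftE g r) *
        ∫⁻ x, f x ∂(m.condKernel r)) (((hI g⁻¹).mul hBg).mul (hK hf))] at h
    simp only [shiftE_shiftE_inv, classIndicator_inv_shiftE] at h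
    simpa only [hs', Function.comp_apply, mul_left_comm, mul_assoc] using h
  filter_upwards [key] with r hr hg
  have hg' : classIndicator g r = 1 := if_pos hg
  simpa [hg'] using hr

end Disintegration

theorem tsum_abs_toReal_lintegral_sub_le {ι X : Type*} [Countable ι] [MeasurableSpace X] {μ : Measure X}
    [IsProbabilityMeasure μ] {u v : X → ι → ℝ} {ε : ℝ} (hε : 0 < ε)
    (hu : ∀ i, Measurable fun x => u x i) (hv : ∀ i, Measurable fun x => v x i)
    (hu0 : ∀ x i, 0 ≤ u x i) (hv0 : ∀ x i, 0 ≤ v x i)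
    (hus : ∀ x, ∑' i, u x i = 1) (hvs : ∀ x, ∑' i, v x i = 1)
    (h : ∀ x, ∑' i, |u x i - v x i| ≤ ε) :
    ∑' i, |(∫⁻ x, ENNReal.ofReal (u x i) ∂μ).toReal -
      (∫⁻ x, ENNReal.ofReal (v x i) ∂μ).toReal| ≤ ε := by
  have hsum : ∀ {w : X → ι → ℝ}, (∀ x, ∑' i, w x i = 1) → ∀ x, Summable (w x) := fun hw x =>
    by_contra fun hn => by simpa [tsum_eq_zero_of_not_summable hn] using hw x
  have hint : ∀ {w : X → ι → ℝ}, (∀ i, Measurable fun x => w x i) → (∀ x i, 0 ≤ w x i) →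
      (∀ x, ∑' i, w x i = 1) → ∀ i, Integrable (fun x => w x i) μ := by
    intro w hw hw0 hws i
    refine Integrable.of_bound (hw i).aestronglyMeasurable 1 (ae_of_all _ fun x => ?_)
    rw [Real.norm_of_nonneg (hw0 x i), ← hws x]
    exact (hsum hws x).le_tsum i fun j _ => hw0 x j
  have hb : ∑' i, ENNReal.ofReal |(∫⁻ x, ENNReal.ofReal (u x i) ∂μ).toReal -
      (∫⁻ x, ENNReal.ofReal (v x i) ∂μ).toReal| ≤ ENNReal.ofReal ε := by
    calc _ ≤ ∑' i, ∫⁻ x, ENNReal.ofReal |u x i - v x i| ∂μ := by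
          refine ENNReal.tsum_le_tsum fun i => ?_
          rw [← integral_eq_lintegral_of_nonneg_ae (ae_of_all _ fun x => hu0 x i)
              (hu i).aestronglyMeasurable,
            ← integral_eq_lintegral_of_nonneg_ae (ae_of_all _ fun x => hv0 x i)
              (hv i).aestronglyMeasurable,
            ← integral_sub (hint hu hu0 hus i) (hint hv hv0 hvs i)]
          simpa [← Real.norm_eq_abs, ofReal_norm] using
            enorm_integral_le_lintegral_enorm (μ := μ) fun x => u x i - v x i
      _ = ∫⁻ x, ∑' i, ENNReal.ofReal |u x i - v x i| ∂μ :=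
          (lintegral_tsum fun i => ((hu i).sub (hv i)).abs.ennreal_ofReal.aemeasurable).symm
      _ ≤ ∫⁻ _, ENNReal.ofReal ε ∂μ := by
          refine lintegral_mono fun x => ?_
          rw [← ENNReal.ofReal_tsum_of_nonneg (fun i => abs_nonneg _)
            ((hsum hus x).sub (hsum hvs x)).abs]
          exact ENNReal.ofReal_le_ofReal (h x)
      _ = ENNReal.ofReal ε := by simp
  have := ENNReal.toReal_mono ENNReal.ofReal_ne_top hb
  rw [ENNReal.tsum_toReal_eq fun _ => ENNReal.ofReal_ne_top, ENNReal.toReal_ofReal hε.le] at this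
  simpa only [ENNReal.toReal_ofReal (abs_nonneg _)] using this

theorem exact_weakLimit_of_FIREs_isAIRE {Γ : Type*} [Group Γ] [Countable Γ]
    (hexact : IsExactGroup Γ)
    (ρs : ℕ → ProbabilityMeasure (EqRelSpace Γ)) (ρ : ProbabilityMeasure (EqRelSpace Γ))
    (hfin : ∀ n, IsFIRE (ρs n)) (hρ : IsIRE ρ)
    (hlim : Tendsto ρs atTop (𝓝 ρ)) :
    IsAIRE ρ := by
  obtain ⟨X, _, a, _, _, _, -, hmul, ha, η, hη0, hη1, hηc, hη⟩ := hexact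
  let _ := TopologicalSpace.metrizableSpaceMetric X
  let _ : MeasurableSpace X := borel X
  have _ : BorelSpace X := ⟨rfl⟩
  obtain ⟨m, hm, hfst⟩ := exists_isClassInvariant_fst_eq ha hmul hfin hlim
  have hηm : ∀ n g, Measurable fun x => ENNReal.ofReal (η n x g) := fun n g =>
    (hηc n g).measurable.ennreal_ofReal
  have hsum : ∀ n x, Summable (η n x) := fun n x =>
    by_contra fun hn => by simpa [tsum_eq_zero_of_not_summable hn] using hη1 n x
  refine ⟨hρ, fun n r g => (∫⁻ x, ENNReal.ofReal (η n x g) ∂(m.toMeasure.condKernel r)).toReal,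
    fun n g => (hηm n g).lintegral_kernel.ennreal_toReal, fun n r g => ENNReal.toReal_nonneg,
    fun n r => ?_, ?_⟩
  · have h1 : ∑' g, ∫⁻ x, ENNReal.ofReal (η n x g) ∂(m.toMeasure.condKernel r) = 1 := by
      rw [← lintegral_tsum fun g => (hηm n g).aemeasurable]
      simp only [← ENNReal.ofReal_tsum_of_nonneg (hη0 n _) (hsum n _), hη1]
      simp
    have hne := ENNReal.ne_top_of_tsum_ne_top (h1.trans_ne ENNReal.one_ne_top)
    exact (ENNReal.tsum_toReal_eq hne).symm.trans (by rw [h1, ENNReal.toReal_one])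
  · have hae : ∀ᵐ r ∂ρ.toMeasure, ∀ (g : Γ) (n : ℕ) (h : Γ), g ∈ classOf r 1 →
        ∫⁻ x, ENNReal.ofReal (η n (a g⁻¹ x) h) ∂(m.toMeasure.condKernel r) =
          ∫⁻ x, ENNReal.ofReal (η n x h) ∂(m.toMeasure.condKernel (shiftE g⁻¹ r)) := by
      refine ae_all_iff.mpr fun g => ae_all_iff.mpr fun n => ae_all_iff.mpr fun h => ?_
      exact hm.ae_lintegral_condKernel (fun g => (ha g).measurable) hρ hfst (hηm n h) g
    filter_upwards [hae] with r hr g hg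
    simp only [← hr g _ _ hg]
    rw [Metric.tendsto_atTop]
    intro ε hε
    obtain ⟨N, hN⟩ := hη g⁻¹ (ε / 2) (half_pos hε)
    refine ⟨N, fun n hn => ?_⟩
    rw [Real.dist_0_eq_abs, abs_of_nonneg (tsum_nonneg fun _ => abs_nonneg _)]
    refine lt_of_le_of_lt ?_ (half_lt_self hε)
    refine tsum_abs_toReal_lintegral_sub_le (u := fun x h => η n x (g * h)) (v := fun x h => η n (a g⁻¹ x) h)
      (half_pos hε) (fun h => (hηc n _).measurable)
      (fun h => ((hηc n h).comp (ha g⁻¹)).measurable)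
      (fun x h => hη0 n x _) (fun x h => hη0 n _ h) (fun x => ?_) (fun x => hη1 n _) fun x => ?_
    · rw [← hη1 n x]
      exact (Equiv.mulLeft g).tsum_eq (η n x)
    · simpa using (hN n hn x).le
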